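/- arXiv:1304.0733 — 3 statements merged into one kernel-verified Lean document; each statement's English description precedes it below -/
import Mathlib

section
/- Let n ≥ 3 and let L be a J-trivial regular language over an alphabet of n - 2 letters with sc(L) = n. Then sc(L^R) ≤ 2^{n-1} - 1. -/
/-- A DFA is *partially ordered* if its reachability relation
`p ≼ q ↔ ∃ w, M.evalFrom p w = q` is antisymmetric (hence a partial order). -/
def DFA.PartiallyOrderedDFA {α σ : Type} (M : DFA α σ) : Prop :=
  ∀ p q : σ, (∃ w : List α, M.evalFrom p w = q) → (∃ w : List α, M.evalFrom q w = p) → p = q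

/-- A DFA is *minimal* if every state is reachable from the initial state and
all pairs of distinct states are distinguishable. -/
def DFA.MinimalDFA {α σ : Type} (M : DFA α σ) : Prop :=
  (∀ q : σ, ∃ w : List α, M.evalFrom M.start w = q) ∧
  (∀ p q : σ, p ≠ q →
    ∃ w : List α, ¬ (M.evalFrom p w ∈ M.accept ↔ M.evalFrom q w ∈ M.accept))

/-- The *state complexity* of a language: the least number of states of a
(complete, deterministic) finite automaton accepting it. -/
noncomputable def stateComplexity {α : Type} (L : Language α) : ℕ :=
  sInf {n : ℕ | ∃ M : DFA α (Fin n), M.accepts = L}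

/-- A regular language is *R-trivial* iff its minimal DFA is partially ordered. -/
def IsRTrivial {α : Type} (L : Language α) : Prop :=
  ∃ (n : ℕ) (M : DFA α (Fin n)), M.MinimalDFA ∧ M.accepts = L ∧ M.PartiallyOrderedDFA

/-- A regular language is *J-trivial* iff the minimal DFAs of both the language
and its reverse are partially ordered. -/
def IsJTrivial {α : Type} (L : Language α) : Prop :=
  IsRTrivial L ∧ IsRTrivial L.reverse

/-- A *dead state*: a non-accepting state with a self-loop under every letter. -/
def DFA.DeadState {α σ : Type} (M : DFA α σ) (d : σ) : Prop :=
  d ∉ M.accept ∧ ∀ a : α, M.step d a = d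

/-- Every finite DFA accepting a language bounds its state complexity. -/
theorem stateComplexity_accepts_le_card {α σ : Type} [Fintype σ] (M : DFA α σ) :
    stateComplexity M.accepts ≤ Fintype.card σ :=
  Nat.sInf_le ⟨DFA.reindex (Fintype.equivFin σ) M, by simp⟩

/-- A minimal DFA has at most as many states as any DFA for the same language. -/
theorem DFA.MinimalDFA.card_le {α σ τ : Type} [Fintype σ] [Fintype τ] {M : DFA α σ}
    (hM : M.MinimalDFA) (N : DFA α τ) (h : M.accepts = N.accepts) :
    Fintype.card σ ≤ Fintype.card τ := by
  choose u hu using hM.1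
  refine Fintype.card_le_of_injective (fun q => N.eval (u q)) fun p q hpq => ?_
  by_contra hne
  obtain ⟨w, hw⟩ := hM.2 p q hne
  have key : ∀ r, M.evalFrom r w ∈ M.accept ↔ N.evalFrom (N.eval (u r)) w ∈ N.accept := by
    intro r
    have h1 : u r ++ w ∈ M.accepts ↔ u r ++ w ∈ N.accepts := by rw [h]
    rw [DFA.mem_accepts, DFA.mem_accepts, DFA.eval, DFA.eval, DFA.evalFrom_of_append,
      DFA.evalFrom_of_append, hu r] at h1
    exact h1
  have hpq' : N.eval (u p) = N.eval (u q) := hpq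
  exact hw (by rw [key p, key q, hpq'])

theorem DFA.MinimalDFA.card_eq_stateComplexity {α σ : Type} [Fintype σ] {M : DFA α σ}
    (hM : M.MinimalDFA) : Fintype.card σ = stateComplexity M.accepts := by
  refine le_antisymm ?_ (stateComplexity_accepts_le_card M)
  obtain ⟨N, hN⟩ : ∃ N : DFA α (Fin (stateComplexity M.accepts)), N.accepts = M.accepts :=
    Nat.sInf_mem (s := {n : ℕ | ∃ N : DFA α (Fin n), N.accepts = M.accepts})
      ⟨Fintype.card σ, DFA.reindex (Fintype.equivFin σ) M, by simp⟩
  simpa using hM.card_le N hN.symm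

/-- The states from which the word `w` is accepted. -/
def DFA.acceptedFrom {α σ : Type} (M : DFA α σ) (w : List α) : Set σ :=
  {q | M.evalFrom q w ∈ M.accept}

theorem DFA.mem_acceptedFrom_cons {α σ : Type} (M : DFA α σ) (a : α) (w : List α) (q : σ) :
    q ∈ M.acceptedFrom (a :: w) ↔ M.step q a ∈ M.acceptedFrom w :=
  Iff.rfl

/-- The subset automaton for the reverse language, restricted to its reachable states. -/
def DFA.reverseSubset {α σ : Type} (M : DFA α σ) : DFA α (Set.range M.acceptedFrom) where
  step S a := ⟨{q | M.step q a ∈ S.1}, by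
    obtain ⟨w, hw⟩ := S.2
    exact ⟨a :: w, by rw [← hw]; rfl⟩⟩
  start := ⟨M.acceptedFrom [], ⟨[], rfl⟩⟩
  accept := {S | M.start ∈ S.1}

theorem DFA.coe_eval_reverseSubset {α σ : Type} (M : DFA α σ) (w : List α) :
    (M.reverseSubset.eval w : Set σ) = M.acceptedFrom w.reverse := by
  induction w using List.reverseRecOn with
  | nil => rfl
  | append_singleton w a ih =>
    rw [DFA.eval_append_singleton]
    change {q | M.step q a ∈ (M.reverseSubset.eval w : Set σ)} = _
    rw [ih, List.reverse_append]
    rfl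

theorem DFA.accepts_reverseSubset {α σ : Type} (M : DFA α σ) :
    M.reverseSubset.accepts = M.accepts.reverse := by
  ext w
  rw [DFA.mem_accepts, Language.mem_reverse, DFA.mem_accepts]
  change M.start ∈ (M.reverseSubset.eval w : Set σ) ↔ _
  rw [M.coe_eval_reverseSubset]
  rfl

/-- If every element of `T` has a prescribed smaller neighbour, a colouring of the complement of
`T` extends to one in which all elements of `T` differ from their neighbours. -/
theorem WellFounded.exists_alternating_coloring {σ : Type*} {r : σ → σ → Prop}
    (hr : WellFounded r) (T base : Set σ) (f : σ → σ) (hf : ∀ q ∈ T, r (f q) q) :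
    ∃ C : Set σ, (∀ q ∈ T, (q ∈ C ↔ f q ∉ C)) ∧ ∀ q ∉ T, (q ∈ C ↔ q ∈ base) := by
  classical
  let C : σ → Prop := hr.fix fun q ih => if h : q ∈ T then ¬ ih (f q) (hf q h) else q ∈ base
  have hC : ∀ q, C q = if q ∈ T then ¬ C (f q) else q ∈ base := by
    intro q
    simp only [C]
    rw [hr.fix_eq]
    split_ifs <;> rfl
  refine ⟨{q | C q}, fun q hq => ?_, fun q hq => ?_⟩
  · change C q ↔ ¬ C (f q)
    rw [hC q, if_pos hq]
  · change C q ↔ _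
    rw [hC q, if_neg hq]

/-- In a partially ordered DFA, repeating a word eventually stops changing the state. -/
theorem DFA.PartiallyOrderedDFA.exists_evalFrom_stable {α σ : Type} [Finite σ] {M : DFA α σ}
    (hM : M.PartiallyOrderedDFA) (v : List α) (x : ℕ → σ)
    (hx : ∀ i, x (i + 1) = M.evalFrom (x i) v) :
    ∃ i, ∀ s t, v = s ++ t → M.evalFrom (x i) s = x i := by
  have reach : ∀ i k, ∃ w, M.evalFrom (x i) w = x (i + k) := by
    intro i k
    induction k with
    | zero => exact ⟨[], rfl⟩
    | succ k ih =>
      obtain ⟨w, hw⟩ := ih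
      exact ⟨w ++ v, by rw [DFA.evalFrom_of_append, hw, ← hx]; rfl⟩
  obtain ⟨i, j, hij, hxij⟩ : ∃ i j, i < j ∧ x i = x j := by
    obtain ⟨i, j, hne, h⟩ := Finite.exists_ne_map_eq_of_infinite x
    rcases lt_or_gt_of_ne hne with hlt | hlt
    · exact ⟨i, j, hlt, h⟩
    · exact ⟨j, i, hlt, h.symm⟩
  refine ⟨i, fun s t hst => (hM _ _ ⟨s, rfl⟩ ?_).symm⟩
  obtain ⟨w, hw⟩ := reach (i + 1) (j - (i + 1))
  refine ⟨t ++ w, ?_⟩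
  rw [← DFA.evalFrom_of_append, ← List.append_assoc, ← hst, DFA.evalFrom_of_append, ← hx, hw, hxij]
  congr 1
  omega

/-- Confluence in minimal DFAs of languages whose reverse is R-trivial. -/
theorem DFA.MinimalDFA.step_eq_step_of_fixed {α σ : Type} {M : DFA α σ} (hM : M.MinimalDFA)
    (hR : IsRTrivial M.accepts.reverse) {p : σ} {a b : α}
    (haa : M.step (M.step p a) a = M.step p a) (hab : M.step (M.step p a) b = M.step p a)
    (hba : M.step (M.step p b) a = M.step p b) (hbb : M.step (M.step p b) b = M.step p b) :
    M.step p a = M.step p b := by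
  wlog hsep : ∃ w, M.evalFrom (M.step p a) w ∈ M.accept ∧ M.evalFrom (M.step p b) w ∉ M.accept
    generalizing a b
  · by_contra hne
    obtain ⟨w, hw⟩ := hM.2 _ _ hne
    by_cases h : M.evalFrom (M.step p a) w ∈ M.accept
    · exact hsep ⟨w, h, fun h' => hw ⟨fun _ => h', fun _ => h⟩⟩
    · exact hne (this hbb hba hab haa ⟨w, by tauto, h⟩).symm
  obtain ⟨w, hwa, hwb⟩ := hsep
  obtain ⟨k, N, -, hN, hPO⟩ := hR
  obtain ⟨u, hu⟩ := hM.1 p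
  -- prepending `ab` repeatedly to `w` corresponds to reading `ba` in `N`
  let x : ℕ → Fin k := fun i => (fun s => N.evalFrom s [b, a])^[i] (N.eval w.reverse)
  have hx : ∀ i, x (i + 1) = N.evalFrom (x i) [b, a] := fun i => by
    simp only [x, Function.iterate_succ_apply']
  have hword : ∀ i, ∃ v, x i = N.eval v.reverse ∧
      M.evalFrom (M.step p a) v ∈ M.accept ∧ M.evalFrom (M.step p b) v ∉ M.accept := by
    intro i
    induction i with
    | zero => exact ⟨w, rfl, hwa, hwb⟩
    | succ i ih =>
      obtain ⟨v, hv, h1, h2⟩ := ih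
      refine ⟨a :: b :: v, ?_, ?_, ?_⟩
      · rw [hx, hv]
        simp [DFA.eval, DFA.evalFrom_of_append]
      · rwa [DFA.evalFrom_cons, DFA.evalFrom_cons, haa, hab]
      · rwa [DFA.evalFrom_cons, DFA.evalFrom_cons, hba, hbb]
  obtain ⟨i, hi⟩ := hPO.exists_evalFrom_stable [b, a] x hx
  obtain ⟨v, hv, h1, h2⟩ := hword i
  have hmem : ∀ z, N.evalFrom (N.eval z.reverse) u.reverse ∈ N.accept ↔
      M.evalFrom p z ∈ M.accept := by
    intro z
    have : (u ++ z).reverse ∈ N.accepts ↔ u ++ z ∈ M.accepts := by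
      rw [hN, Language.mem_reverse, List.reverse_reverse]
    rw [DFA.mem_accepts, DFA.mem_accepts, List.reverse_append, DFA.eval, DFA.eval,
      DFA.evalFrom_of_append, DFA.evalFrom_of_append, hu] at this
    exact this
  have hb : N.eval (b :: v).reverse = x i := by
    rw [← hi [b] [a] rfl, hv]
    simp [DFA.eval]
  have hba' : N.eval (a :: b :: v).reverse = x i := by
    rw [← hi [b, a] [] rfl, hv]
    simp [DFA.eval, DFA.evalFrom_of_append]
  have hB := hmem (b :: v)
  have hA := hmem (a :: b :: v)
  rw [hb] at hB
  rw [hba', hB, DFA.evalFrom_cons, DFA.evalFrom_cons, DFA.evalFrom_cons, hab] at hA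
  exact absurd (hA.2 h1) h2

/-- In a partially ordered DFA, strict reachability is well-founded. -/
theorem DFA.PartiallyOrderedDFA.wellFounded {α σ : Type} [Finite σ] {M : DFA α σ}
    (hM : M.PartiallyOrderedDFA) :
    WellFounded fun q p : σ => p ≠ q ∧ ∃ w, M.evalFrom p w = q := by
  have : IsTrans σ fun q p : σ => p ≠ q ∧ ∃ w, M.evalFrom p w = q := by
    refine ⟨?_⟩
    rintro r q p ⟨hqr, w, hw⟩ ⟨hpq, v, hv⟩
    refine ⟨?_, v ++ w, by rw [DFA.evalFrom_of_append, hv, hw]⟩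
    rintro rfl
    exact hpq (hM _ _ ⟨v, hv⟩ ⟨w, hw⟩)
  have : Std.Irrefl fun q p : σ => p ≠ q ∧ ∃ w, M.evalFrom p w = q := ⟨fun p h => h.1 rfl⟩
  exact Finite.wellFounded_of_trans_of_irrefl _

/-- A set separating, for each letter `a`, some state from its `a`-successor that is fixed
by `a`, can be of the form `M.acceptedFrom w` only for `w` acting like the empty word. -/
theorem DFA.acceptedFrom_eq_accept_of_alternating {α σ : Type} (M : DFA α σ) {C : Set σ}
    (hC : ∀ a, (∀ q, M.step q a = q) ∨
      ∃ p, M.step (M.step p a) a = M.step p a ∧ (p ∈ C ↔ M.step p a ∉ C))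
    {w : List α} (hw : M.acceptedFrom w = C) : C = M.accept := by
  induction w with
  | nil => exact hw.symm
  | cons a w ih =>
    rcases hC a with h | ⟨p, hp, hpC⟩
    · refine ih (hw ▸ ?_)
      ext q
      rw [DFA.mem_acceptedFrom_cons, h]
    · rw [← hw, DFA.mem_acceptedFrom_cons, DFA.mem_acceptedFrom_cons, hp] at hpC
      tauto

theorem DFA.mem_acceptedFrom_iff_of_fixed {α σ : Type} (M : DFA α σ) {d : σ}
    (hd : ∀ a, M.step d a = d) (w : List α) : d ∈ M.acceptedFrom w ↔ d ∈ M.accept := by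
  induction w with
  | nil => rfl
  | cons a w ih => rw [DFA.mem_acceptedFrom_cons, hd, ih]

theorem DFA.MinimalDFA.card_range_acceptedFrom_lt {α σ : Type} [Fintype α] [Fintype σ]
    {M : DFA α σ} (hM : M.MinimalDFA) (hPO : M.PartiallyOrderedDFA)
    (hR : IsRTrivial M.accepts.reverse) (hcard : Fintype.card α + 1 < Fintype.card σ) :
    Nat.card (Set.range M.acceptedFrom) < 2 ^ (Fintype.card σ - 1) := by
  classical
  have wf := hPO.wellFounded
  obtain ⟨d, -, hd⟩ := wf.has_min Set.univ ⟨M.start, trivial⟩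
  replace hd : ∀ a, M.step d a = d := fun a => by
    by_contra h
    exact hd _ trivial ⟨Ne.symm h, [a], rfl⟩
  have hP : ∀ a, ∃ p, (∀ q, M.step q a = q) ∨
      (M.step p a ≠ p ∧ ∀ w, M.evalFrom p w ≠ p →
        M.step (M.evalFrom p w) a = M.evalFrom p w) := by
    intro a
    by_cases h : ∀ q, M.step q a = q
    · exact ⟨d, Or.inl h⟩
    · push Not at h
      obtain ⟨p, hp, hmin⟩ := wf.has_min {q | M.step q a ≠ q} h
      refine ⟨p, Or.inr ⟨hp, fun w hw => ?_⟩⟩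
      by_contra h'
      exact hmin _ h' ⟨hw.symm, w, rfl⟩
  choose P hP using hP
  let T : Set σ := {q | ∃ a, P a = q ∧ M.step q a ≠ q}
  have hT : ∀ q, ∃ q', ∀ a, P a = q → M.step q a ≠ q → M.step q a = q' := by
    intro q
    by_cases hq : q ∈ T
    · obtain ⟨b, hPb, hb⟩ := hq
      refine ⟨M.step q b, fun a hPa ha => ?_⟩
      have ha' := (hP a).resolve_left fun h => ha (h q)
      have hb' := (hP b).resolve_left fun h => hb (h q)
      rw [hPa] at ha'
      rw [hPb] at hb'
      exact hM.step_eq_step_of_fixed hR (ha'.2 [a] ha) (hb'.2 [a] ha) (ha'.2 [b] hb)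
        (hb'.2 [b] hb)
    · exact ⟨q, fun a hPa ha => (hq ⟨a, hPa, ha⟩).elim⟩
  choose f hf using hT
  have hfr : ∀ q ∈ T, q ≠ f q ∧ ∃ w, M.evalFrom q w = f q := by
    rintro q ⟨a, hPa, ha⟩
    rw [← hf q a hPa ha]
    exact ⟨ha.symm, [a], rfl⟩
  have hdT : d ∉ T := fun ⟨a, _, ha⟩ => ha (hd a)
  obtain ⟨r, hr⟩ : ∃ r, r ∉ insert d (Finset.univ.image P) := by
    by_contra! h
    have h1 := Finset.card_le_card fun (x : σ) (_ : x ∈ Finset.univ) => h x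
    have h2 := Finset.card_insert_le d (Finset.univ.image P)
    have h3 := Finset.card_image_le (s := Finset.univ) (f := P)
    simp only [Finset.card_univ] at h1 h3
    omega
  simp only [Finset.mem_insert, Finset.mem_image, Finset.mem_univ, true_and, not_or] at hr
  have hrT : r ∉ T := fun ⟨a, hPa, _⟩ => hr.2 ⟨a, hPa⟩
  obtain ⟨C, hCd, hCr, hC⟩ : ∃ C : Set σ, (d ∈ C ↔ d ∈ M.accept) ∧ (r ∈ C ↔ r ∉ M.accept) ∧
      ∀ q ∈ T, (q ∈ C ↔ f q ∉ C) := by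
    obtain ⟨C, h1, h2⟩ := wf.exists_alternating_coloring T
      {q | (q = d ∧ d ∈ M.accept) ∨ (q = r ∧ r ∉ M.accept)} f hfr
    refine ⟨C, ?_, ?_, h1⟩
    · rw [h2 d hdT]
      simp [Ne.symm hr.1]
    · rw [h2 r hrT]
      simp [hr.1]
  have hCrange : C ∉ Set.range M.acceptedFrom := by
    rintro ⟨w, hw⟩
    have hCF := M.acceptedFrom_eq_accept_of_alternating (C := C) (fun a => ?_) hw
    · rw [hCF] at hCr
      tauto
    · rcases hP a with h | ⟨h1, h2⟩
      · exact Or.inl h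
      · refine Or.inr ⟨P a, h2 [a] h1, ?_⟩
        rw [hf (P a) a rfl h1]
        exact hC _ ⟨a, rfl, h1⟩
  let φ : Set σ → Set {q // q ≠ d} := fun S => Subtype.val ⁻¹' S
  have hφ : ∀ S S' : Set σ, (d ∈ S ↔ d ∈ S') → φ S = φ S' → S = S' := by
    intro S S' h h'
    ext q
    by_cases hq : q = d
    · rwa [hq]
    · exact Set.ext_iff.1 h' ⟨q, hq⟩
  have hlt := Fintype.card_lt_of_injective_not_surjective
    (fun S : Set.range M.acceptedFrom => φ S.1) ?_ ?_
  · rw [Nat.card_eq_fintype_card]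
    simpa [Fintype.card_set, Fintype.card_subtype_compl] using hlt
  · rintro ⟨_, w, rfl⟩ ⟨_, w', rfl⟩ h
    exact Subtype.ext (hφ _ _ (by
      rw [M.mem_acceptedFrom_iff_of_fixed hd, M.mem_acceptedFrom_iff_of_fixed hd]) h)
  · intro hs
    obtain ⟨⟨_, w, rfl⟩, h⟩ := hs (φ C)
    exact hCrange ⟨w, hφ _ _ (by rw [M.mem_acceptedFrom_iff_of_fixed hd, hCd]) h⟩

theorem statement12 (n : ℕ) (hn : 3 ≤ n) (L : Language (Fin (n - 2)))
    (hJ : IsJTrivial L) (hsc : stateComplexity L = n) :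
    stateComplexity L.reverse ≤ 2 ^ (n - 1) - 1 := by
  classical
  obtain ⟨⟨m, M, hM, rfl, hPO⟩, hR⟩ := hJ
  have hm : m = n := by
    rw [← hsc, ← hM.card_eq_stateComplexity, Fintype.card_fin]
  have h1 := hM.card_range_acceptedFrom_lt hPO hR (by simp only [Fintype.card_fin]; omega)
  have h2 := stateComplexity_accepts_le_card M.reverseSubset
  rw [M.accepts_reverseSubset, ← Nat.card_eq_fintype_card] at h2
  rw [Fintype.card_fin] at h1
  have h3 : 2 ^ (m - 1) = 2 ^ (n - 1) := by rw [hm]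
  omega
end

section
/- For every n ≥ 3 there exists a J-trivial regular language L over an alphabet of exactly n - 2 letters with sc(L) = n and sc(L^R) = 2^{n-1} - 1. -/
namespace DFA

variable {α σ τ : Type}

theorem MinimalDFA.reindex {M : DFA α σ} (hM : M.MinimalDFA) (g : σ ≃ τ) :
    (DFA.reindex g M).MinimalDFA := by
  refine ⟨fun q => ?_, fun p q hpq => ?_⟩
  · obtain ⟨w, hw⟩ := hM.1 (g.symm q)
    exact ⟨w, by simp [evalFrom_reindex, hw]⟩
  · obtain ⟨w, hw⟩ := hM.2 (g.symm p) (g.symm q) (by simpa using hpq)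
    exact ⟨w, by simpa [evalFrom_reindex] using hw⟩

theorem PartiallyOrderedDFA.reindex {M : DFA α σ} (hM : M.PartiallyOrderedDFA) (g : σ ≃ τ) :
    (DFA.reindex g M).PartiallyOrderedDFA := by
  rintro p q ⟨u, hu⟩ ⟨v, hv⟩
  rw [evalFrom_reindex, ← g.eq_symm_apply] at hu hv
  exact g.symm.injective (hM _ _ ⟨u, hu⟩ ⟨v, hv⟩)

theorem MinimalDFA.card_le_s13 {M : DFA α σ} (hM : M.MinimalDFA) [Finite τ] {N : DFA α τ}
    (h : N.accepts = M.accepts) : Nat.card σ ≤ Nat.card τ := by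
  choose f hf using hM.1
  refine Nat.card_le_card_of_injective (fun q => N.eval (f q)) fun p q hpq => ?_
  by_contra hne
  obtain ⟨w, hw⟩ := hM.2 p q hne
  refine hw ?_
  have key (r : σ) : M.evalFrom r w ∈ M.accept ↔ N.evalFrom (N.eval (f r)) w ∈ N.accept := by
    rw [← hf r, ← evalFrom_of_append, hf r, DFA.eval, ← evalFrom_of_append]
    exact (Set.ext_iff.mp h (f r ++ w)).symm
  rw [key, key, show N.eval (f p) = N.eval (f q) from hpq]

theorem MinimalDFA.stateComplexity_eq [Finite σ] {M : DFA α σ} (hM : M.MinimalDFA) :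
    stateComplexity M.accepts = Nat.card σ := by
  refine IsLeast.csInf_eq ⟨⟨DFA.reindex (Finite.equivFin σ) M, by simp⟩, ?_⟩
  rintro k ⟨N, hN⟩
  simpa using hM.card_le_s13 hN

theorem MinimalDFA.isRTrivial [Finite σ] {M : DFA α σ} (hM : M.MinimalDFA)
    (hpo : M.PartiallyOrderedDFA) : IsRTrivial M.accepts :=
  ⟨_, DFA.reindex (Finite.equivFin σ) M, hM.reindex _, by simp, hpo.reindex _⟩

/-- The set of states from which `M` accepts `w`. -/
def acceptingStates (M : DFA α σ) (w : List α) : Set σ :=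
  {p | M.evalFrom p w ∈ M.accept}

/-- The accessible part of the subset automaton of the reversal of `M`. -/
def reverseSubset_s13 (M : DFA α σ) : DFA α (Set.range M.acceptingStates) where
  step S a := ⟨{p | M.step p a ∈ S.1}, by
    obtain ⟨_, w, rfl⟩ := S
    exact ⟨a :: w, rfl⟩⟩
  start := ⟨M.accept, [], rfl⟩
  accept := {S | M.start ∈ S.1}

theorem mem_evalFrom_reverseSubset (M : DFA α σ) (S : Set.range M.acceptingStates)
    (w : List α) (p : σ) :
    p ∈ (M.reverseSubset_s13.evalFrom S w).1 ↔ M.evalFrom p w.reverse ∈ S.1 := by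
  induction w generalizing S with
  | nil => simp
  | cons a w ih =>
    rw [evalFrom_cons, ih, List.reverse_cons, evalFrom_append_singleton]
    rfl

theorem accepts_reverseSubset_s13 (M : DFA α σ) : M.reverseSubset_s13.accepts = M.accepts.reverse := by
  ext w
  rw [Language.mem_reverse]
  exact M.mem_evalFrom_reverseSubset _ w M.start

theorem minimalDFA_reverseSubset {M : DFA α σ}
    (hM : ∀ q : σ, ∃ w : List α, M.evalFrom M.start w = q) : M.reverseSubset_s13.MinimalDFA := by
  constructor
  · rintro ⟨_, w, rfl⟩
    refine ⟨w.reverse, Subtype.ext (Set.ext fun p => ?_)⟩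
    rw [mem_evalFrom_reverseSubset, List.reverse_reverse]
    rfl
  · intro S T hST
    obtain ⟨p, hp⟩ : ∃ p, ¬ (p ∈ S.1 ↔ p ∈ T.1) := by
      by_contra! h
      exact hST (Subtype.ext (Set.ext h))
    obtain ⟨u, rfl⟩ := hM p
    refine ⟨u.reverse, fun h => hp ?_⟩
    have := (M.mem_evalFrom_reverseSubset S u.reverse M.start).symm.trans
      (h.trans (M.mem_evalFrom_reverseSubset T u.reverse M.start))
    rwa [List.reverse_reverse] at this

section Order

variable [PartialOrder σ] {M : DFA α σ}

theorem le_evalFrom (hle : ∀ p a, p ≤ M.step p a) (p : σ) (w : List α) :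
    p ≤ M.evalFrom p w := by
  induction w generalizing p with
  | nil => rfl
  | cons a w ih => exact (hle p a).trans (ih _)

theorem monotone_evalFrom (hmono : ∀ a, Monotone fun p => M.step p a) (w : List α) :
    Monotone fun p => M.evalFrom p w := by
  induction w with
  | nil => exact monotone_id
  | cons a w ih => exact ih.comp (hmono a)

theorem partiallyOrderedDFA_of_le_step (hle : ∀ p a, p ≤ M.step p a) :
    M.PartiallyOrderedDFA := by
  rintro p q ⟨u, rfl⟩ ⟨v, hv⟩
  exact le_antisymm (le_evalFrom hle p u) ((le_evalFrom hle _ v).trans_eq hv)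

end Order

end DFA

/-- A set invariant under pulling back along a monotone extensive map `h` does not separate `i`
from any point between `i` and `h i`. -/
theorem mem_iff_mem_of_le_of_le {σ : Type} [PartialOrder σ] [WellFoundedGT σ] {h : σ → σ}
    (hmono : Monotone h) {S : Set σ} (hS : ∀ i, h i ∈ S ↔ i ∈ S) (i : σ) :
    ∀ j, i ≤ j → j ≤ h i → (j ∈ S ↔ i ∈ S) := by
  induction i using WellFoundedGT.induction with
  | ind i ih =>
    intro j hij hj
    rcases hij.eq_or_lt with rfl | hlt
    · rfl
    · rw [← hS i]
      exact (ih j hlt (h i) hj (hmono hij)).symm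

theorem DFA.partiallyOrderedDFA_reverseSubset {α σ : Type} [PartialOrder σ] [WellFoundedGT σ]
    {M : DFA α σ} (hle : ∀ p a, p ≤ M.step p a) (hmono : ∀ a, Monotone fun p => M.step p a) :
    M.reverseSubset_s13.PartiallyOrderedDFA := by
  rintro S T ⟨u, hu⟩ ⟨v, hv⟩
  have hT (p : σ) : p ∈ T.1 ↔ M.evalFrom p u.reverse ∈ S.1 := by
    rw [← hu, M.mem_evalFrom_reverseSubset]
  have hS (p : σ) : p ∈ S.1 ↔ M.evalFrom p v.reverse ∈ T.1 := by
    rw [← M.mem_evalFrom_reverseSubset, hv]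
  have hmu := M.monotone_evalFrom hmono u.reverse
  refine Subtype.ext (Set.ext fun p => ?_)
  rw [hT]
  exact (mem_iff_mem_of_le_of_le (hmu.comp (M.monotone_evalFrom hmono v.reverse))
    (fun i => ((hS i).trans (hT _)).symm) p _ (M.le_evalFrom hle p _)
    (hmu (M.le_evalFrom hle p _))).symm

/-- The DFA on the chain `0 < 1 < ⋯ < n - 1` whose letter `k` moves `k + 1` to `k + 2`, whose
letter `0` also moves `0` to `1`, and whose accepting states alternate along the chain, the last
state being rejecting. -/
def chainDFA (n : ℕ) (hn : 0 < n) : DFA (Fin (n - 2)) (Fin n) where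
  step p k := if h : p.1 = k.1 + 1 ∨ p.1 = 0 ∧ k.1 = 0 then ⟨p.1 + 1, by omega⟩ else p
  start := ⟨0, hn⟩
  accept := {p | (p.1 + n) % 2 = 0}

namespace chainDFA

variable {n : ℕ} {hn : 0 < n}

theorem step_val (p : Fin n) (k : Fin (n - 2)) :
    ((chainDFA n hn).step p k).1 =
      if p.1 = k.1 + 1 ∨ p.1 = 0 ∧ k.1 = 0 then p.1 + 1 else p.1 := by
  simp only [chainDFA]
  split_ifs <;> rfl

theorem mem_accept (p : Fin n) : p ∈ (chainDFA n hn).accept ↔ (p.1 + n) % 2 = 0 := Iff.rfl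

theorem le_step (p : Fin n) (k : Fin (n - 2)) : p ≤ (chainDFA n hn).step p k := by
  rw [Fin.le_def, step_val]
  split_ifs <;> omega

theorem monotone_step (k : Fin (n - 2)) : Monotone fun p => (chainDFA n hn).step p k := by
  intro p q hpq
  rw [Fin.le_def] at hpq
  simp only [Fin.le_def, step_val]
  split_ifs <;> omega

theorem exists_evalFrom_start_eq (h3 : 3 ≤ n) (q : Fin n) :
    ∃ w, (chainDFA n hn).evalFrom (chainDFA n hn).start w = q := by
  obtain ⟨q, hq⟩ := q
  induction q with
  | zero => exact ⟨[], rfl⟩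
  | succ q ih =>
    obtain ⟨w, hw⟩ := ih (by omega)
    refine ⟨w ++ [⟨q - 1, by omega⟩], Fin.ext ?_⟩
    rw [DFA.evalFrom_append_singleton, hw, step_val]
    split_ifs with h
    · rfl
    · simp only at h ⊢
      omega

theorem evalFrom_last (p : Fin n) (hp : p.1 = n - 1) (w : List (Fin (n - 2))) :
    (chainDFA n hn).evalFrom p w = p := by
  refine le_antisymm ?_ (DFA.le_evalFrom le_step p w)
  rw [Fin.le_def]
  omega

/-- `Flips n hn D` says that the states at which the set of states accepting some word differs from
the set of accepting states are those in `D`. -/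
def Flips (n : ℕ) (hn : 0 < n) (D : ℕ → Prop) : Prop :=
  ∃ w, ∀ p : Fin n, (chainDFA n hn).evalFrom p w ∈ (chainDFA n hn).accept ↔
    ((p.1 + n) % 2 = 0 ↔ ¬ D p)

theorem flips_empty {D : ℕ → Prop} (hD : ∀ p < n, ¬ D p) : Flips n hn D :=
  ⟨[], fun p => by simp [mem_accept, hD p p.2]⟩

theorem Flips.step {D D' : ℕ → Prop} (hD : Flips n hn D) (k : ℕ) (hk : k + 2 < n)
    (h : ∀ p < n, D' p ↔ if p = k + 1 ∨ p = 0 ∧ k = 0 then ¬ D (p + 1) else D p) :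
    Flips n hn D' := by
  obtain ⟨w, hw⟩ := hD
  refine ⟨⟨k, by omega⟩ :: w, fun p => ?_⟩
  rw [DFA.evalFrom_cons, hw, step_val, h p p.2]
  split_ifs with hp
  · rw [show (p.1 + 1 + n) % 2 = 0 ↔ ¬ (p.1 + n) % 2 = 0 by omega]
    tauto
  · rfl

theorem Flips.insert {D D' : ℕ → Prop} (hD : Flips n hn D) (i : ℕ) (hi : 2 ≤ i) (hin : i + 1 < n)
    (hDi : ¬ D (i + 1)) (h : ∀ p < n, D' p ↔ p = i ∨ D p) : Flips n hn D' := by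
  refine hD.step (i - 1) (by omega) fun p hp => ?_
  rw [h p hp]
  split_ifs with hpi
  · obtain rfl : p = i := by omega
    simp [hDi]
  · simp [show p ≠ i by omega]

theorem Flips.extend {D : ℕ → Prop} (hDn : ∀ p, D p → p + 1 < n) {j : ℕ} (hj : 2 ≤ j)
    (hD : Flips n hn fun p => D p ∧ p < j) (l : ℕ) (hl : j ≤ l) :
    Flips n hn fun p => D p ∧ p < l := by
  induction l, hl using Nat.le_induction with
  | base => exact hD
  | succ l hl ih =>
    by_cases hDl : D l
    · refine ih.insert l (by omega) (hDn l hDl) (by simp) fun p _ => ?_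
      rcases eq_or_ne p l with rfl | hpl
      · simp [hDl]
      · simp only [hpl, false_or, and_congr_right_iff]
        omega
    · convert ih using 2 with p
      refine and_congr_right fun hp => ?_
      have : p ≠ l := fun h => hDl (h ▸ hp)
      omega

theorem flips_zero_pair (j : ℕ) (hj : 2 ≤ j) (hjn : j + 1 < n) :
    Flips n hn fun p => p = 0 ∨ p = j := by
  induction j, hj using Nat.le_induction with
  | base =>
    have h2 : Flips n hn fun p => p = 2 :=
      (flips_empty (D := fun _ => False) (by simp)).insert 2 le_rfl hjn (by simp) (by simp)
    refine h2.step 0 (by omega) fun p _ => ?_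
    split_ifs <;> omega
  | succ j hj ih =>
    have h1 : Flips n hn fun p => p = j + 1 ∨ p = 0 ∨ p = j :=
      (ih (by omega)).insert (j + 1) (by omega) hjn (by omega) (by simp)
    refine h1.step (j - 1) (by omega) fun p _ => ?_
    split_ifs <;> omega

theorem flips_of_ne (h3 : 3 ≤ n) {D : ℕ → Prop} (hDn : ∀ p, D p → p + 1 < n)
    (hD : ¬ ∀ p, D p ↔ p = 0) : Flips n hn D := by
  suffices ∃ j ≥ 2, Flips n hn fun p => D p ∧ p < j by
    obtain ⟨j, hj, h⟩ := this
    convert h.extend hDn hj (n + j) (by omega) using 1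
    exact funext fun p => propext ⟨fun hp => ⟨hp, by have := hDn p hp; omega⟩, And.left⟩
  have h0 : Flips n hn fun _ => False := flips_empty (by simp)
  have h01 : Flips n hn fun p => p = 0 ∨ p = 1 := by
    refine h0.step 0 (by omega) fun p _ => ?_
    split_ifs <;> simp <;> omega
  have h1 : Flips n hn fun p => p = 1 := by
    refine h01.step 0 (by omega) fun p _ => ?_
    split_ifs <;> simp <;> omega
  have hlt (p : ℕ) : D p ∧ p < 2 ↔ p = 0 ∧ D 0 ∨ p = 1 ∧ D 1 := by
    constructor
    · rintro ⟨hp, hp2⟩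
      interval_cases p <;> simp [hp]
    · rintro (⟨rfl, h⟩ | ⟨rfl, h⟩) <;> simp [h]
  by_cases hD1 : D 1
  · refine ⟨2, le_rfl, ?_⟩
    by_cases hD0 : D 0 <;> simpa only [hlt, hD0, hD1, and_true, and_false, false_or]
  by_cases hD0 : D 0
  · have hex : ∃ j, D j ∧ j ≠ 0 := by
      by_contra! h
      exact hD fun p => ⟨h p, fun hp => hp ▸ hD0⟩
    classical
    obtain ⟨hj, hj0⟩ := Nat.find_spec hex
    have hmin (p : ℕ) (hp : p < Nat.find hex) (hDp : D p) : p = 0 := by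
      simpa [hDp] using Nat.find_min hex hp
    generalize Nat.find hex = j at hj hj0 hmin
    have hj1 : j ≠ 1 := fun h => hD1 (h ▸ hj)
    refine ⟨j + 1, by omega, ?_⟩
    convert flips_zero_pair j (by omega) (hDn j hj) using 2 with p
    constructor
    · rintro ⟨hp, hpj⟩
      by_cases h : p = j
      · exact Or.inr h
      · exact Or.inl (hmin p (by omega) hp)
    · rintro (rfl | rfl)
      · exact ⟨hD0, by omega⟩
      · exact ⟨hj, by omega⟩
  · exact ⟨2, le_rfl, by simpa only [hlt, hD0, hD1, and_false, or_self]⟩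

theorem range_acceptingStates (h3 : 3 ≤ n) :
    Set.range (chainDFA n hn).acceptingStates =
      𝒫 {(⟨n - 1, by omega⟩ : Fin n)}ᶜ \ {{p | (p.1 + n) % 2 = 0 ↔ p.1 ≠ 0}} := by
  ext S
  simp only [Set.mem_sdiff, Set.mem_powerset_iff, Set.subset_compl_singleton_iff,
    Set.mem_singleton_iff]
  constructor
  · rintro ⟨w, rfl⟩
    constructor
    · simp only [DFA.acceptingStates, Set.mem_ofPred_eq]
      rw [evalFrom_last _ rfl, mem_accept]
      simp only
      omega
    · intro h
      have key (p : Fin n) :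
          (chainDFA n hn).evalFrom p w ∈ (chainDFA n hn).accept ↔
            ((p.1 + n) % 2 = 0 ↔ p.1 ≠ 0) := Set.ext_iff.mp h p
      cases w with
      | nil =>
        have := key ⟨0, hn⟩
        simp only [DFA.evalFrom_nil, mem_accept] at this
        omega
      | cons k w =>
        have h1 := key ⟨k + 1, by omega⟩
        have h2 := key ⟨k + 2, by omega⟩
        rw [DFA.evalFrom_cons] at h1 h2
        have e1 : (chainDFA n hn).step ⟨k + 1, by omega⟩ k = ⟨k + 2, by omega⟩ :=
          Fin.ext (by simp [step_val])
        have e2 : (chainDFA n hn).step ⟨k + 2, by omega⟩ k = ⟨k + 2, by omega⟩ :=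
          Fin.ext (by simp [step_val])
        rw [e1] at h1
        rw [e2] at h2
        have := h1.symm.trans h2
        simp only at this
        omega
  · rintro ⟨hlast, hS⟩
    obtain ⟨w, hw⟩ : Flips n hn fun p => ∃ h : p < n, ¬ ((p + n) % 2 = 0 ↔ ⟨p, h⟩ ∈ S) := by
      refine flips_of_ne h3 (fun p ⟨h, hp⟩ => ?_) fun h => hS (Set.ext fun p => ?_)
      · by_contra hpn
        obtain rfl : p = n - 1 := by omega
        exact hp (iff_of_false (by omega) hlast)
      · have := h p
        simp only [p.2, exists_true_left] at this
        simp only [Set.mem_ofPred_eq]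
        tauto
    refine ⟨w, Set.ext fun p => (hw p).trans ?_⟩
    simp only [p.2, exists_true_left]
    tauto

theorem card_range_acceptingStates (h3 : 3 ≤ n) :
    Nat.card (Set.range (chainDFA n hn).acceptingStates) = 2 ^ (n - 1) - 1 := by
  rw [Nat.card_coe_set_eq, range_acceptingStates h3, Set.ncard_sdiff_singleton_of_mem,
    Set.ncard_powerset, Set.ncard_compl, Set.ncard_singleton, Nat.card_fin]
  simp only [Set.mem_powerset_iff, Set.subset_compl_singleton_iff, Set.mem_ofPred_eq]
  omega

theorem exists_not_accept_iff_accept (h3 : 3 ≤ n) {p q : Fin n} (hpq : p < q) :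
    ∃ w, ¬ ((chainDFA n hn).evalFrom p w ∈ (chainDFA n hn).accept ↔
      (chainDFA n hn).evalFrom q w ∈ (chainDFA n hn).accept) := by
  rw [Fin.lt_def] at hpq
  by_cases hpar : (p.1 + q.1) % 2 = 0
  · obtain ⟨w, hw⟩ : Flips n hn fun i => i = p.1 ∨ i = 1 ∧ p.1 = 0 := by
      refine flips_of_ne h3 (fun i hi => by omega) fun h => ?_
      have h0 := h p
      have h1 := h 1
      omega
    refine ⟨w, ?_⟩
    rw [hw, hw]
    omega
  · refine ⟨[], ?_⟩
    simp only [DFA.evalFrom_nil, mem_accept]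
    omega

theorem minimalDFA (h3 : 3 ≤ n) : (chainDFA n hn).MinimalDFA := by
  refine ⟨exists_evalFrom_start_eq h3, fun p q hpq => ?_⟩
  rcases hpq.lt_or_gt with h | h
  · exact exists_not_accept_iff_accept h3 h
  · obtain ⟨w, hw⟩ := exists_not_accept_iff_accept (hn := hn) h3 h
    exact ⟨w, fun e => hw e.symm⟩

end chainDFA

theorem statement13 (n : ℕ) (hn : 3 ≤ n) :
    ∃ L : Language (Fin (n - 2)), IsJTrivial L ∧ stateComplexity L = n ∧
      stateComplexity L.reverse = 2 ^ (n - 1) - 1 := by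
  have hn0 : 0 < n := by omega
  have hM := chainDFA.minimalDFA (hn := hn0) hn
  have hR := DFA.minimalDFA_reverseSubset hM.1
  refine ⟨(chainDFA n hn0).accepts, ⟨hM.isRTrivial ?_, ?_⟩, ?_, ?_⟩
  · exact DFA.partiallyOrderedDFA_of_le_step chainDFA.le_step
  · rw [← DFA.accepts_reverseSubset_s13]
    exact hR.isRTrivial
      (DFA.partiallyOrderedDFA_reverseSubset chainDFA.le_step chainDFA.monotone_step)
  · rw [hM.stateComplexity_eq, Nat.card_fin]
  · rw [← DFA.accepts_reverseSubset_s13, hR.stateComplexity_eq,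
      chainDFA.card_range_acceptingStates hn]
end

section
/- Let M = (Q, Σ, δ, q₀, F) be a DFA in which every state is reachable from q₀. For X ⊆ Q and a word w, define pre_w(X) = {q ∈ Q : δ(q,w) ∈ X} (the state of the subset automaton of the reversed automaton M^R reached from X by w). Then any two distinct subsets S, T ⊆ Q are distinguishable in the subset automaton of M^R: there exists a word w such that exactly one of pre_w(S) and pre_w(T) contains q₀. In particular, all states of the subset automaton of the reverse of a minimal DFA are pairwise distinguishable. -/
theorem statement18 {α σ : Type} (M : DFA α σ)
    (hreach : ∀ q : σ, ∃ w : List α, M.evalFrom M.start w = q)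
    (S T : Set σ) (hST : S ≠ T) :
    ∃ w : List α,
      ¬ ((M.start ∈ {q : σ | M.evalFrom q w ∈ S}) ↔
         (M.start ∈ {q : σ | M.evalFrom q w ∈ T})) := by
  by_contra! h
  refine hST (Set.ext fun q => ?_)
  obtain ⟨w, rfl⟩ := hreach q
  exact h w
end
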